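/- arXiv:1708.00916 — 5 statements merged into one kernel-verified Lean document; each statement's English description precedes it below -/
import Mathlib

section
/- Let k ≥ 1 and let n_1, …, n_k be nonzero integers, with V the associated state matrix over ℚ. Let P(t) = det(V − t·Vᵀ), regarded as a polynomial in ℚ[t]. Then P has degree exactly k, its constant coefficient is P(0) = ∏_{i=1}^k (−1)^{i+1} n_i/2, and its leading coefficient (the coefficient of t^k) is (−1)^k · ∏_{i=1}^k (−1)^{i+1} n_i/2. In particular the constant and leading coefficients both have absolute value (n_1 n_2 ⋯ n_k)/2^k in absolute value, namely (∏_{i=1}^k |n_i|)/2^k. -/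
open Matrix Polynomial

/-- Let `k ≥ 1` and let `n_1, …, n_k` be nonzero integers, with `V` the
associated state matrix over `ℚ` (diagonal entries `(-1)^{i+1} n_i / 2`, subdiagonal
entries `1`, all other entries `0`, 1-indexed).  The polynomial
`P(t) = det (V - t Vᵀ) ∈ ℚ[t]` has degree exactly `k`, constant coefficient
`∏_{i=1}^k (-1)^{i+1} n_i / 2`, leading coefficient `(-1)^k ∏_{i=1}^k (-1)^{i+1} n_i / 2`,
and both coefficients have absolute value `(∏ |n_i|) / 2^k`.  (Theorem 3.1(iv).) -/
theorem state_polynomial_degree_and_leading_coeff (k : ℕ) (hk : 1 ≤ k)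
    (n : ℕ → ℤ) (hn : ∀ i, 1 ≤ i → i ≤ k → n i ≠ 0)
    (V : Matrix (Fin k) (Fin k) ℚ)
    (hV : ∀ i j : Fin k, V i j =
      if i = j then (-1) ^ (i : ℕ) * (n ((i : ℕ) + 1) : ℚ) / 2
      else if (i : ℕ) = (j : ℕ) + 1 then 1 else 0)
    (P : Polynomial ℚ)
    (hP : P = (V.map Polynomial.C - (Polynomial.X : Polynomial ℚ) • (Vᵀ).map Polynomial.C).det) :
    P.natDegree = k ∧ P.coeff k ≠ 0 ∧
    P.coeff 0 = ∏ i ∈ Finset.range k, ((-1) ^ i * (n (i + 1) : ℚ) / 2) ∧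
    P.coeff k = (-1) ^ k * ∏ i ∈ Finset.range k, ((-1) ^ i * (n (i + 1) : ℚ) / 2) ∧
    |P.coeff 0| = (∏ i ∈ Finset.range k, |(n (i + 1) : ℚ)|) / 2 ^ k ∧
    |P.coeff k| = (∏ i ∈ Finset.range k, |(n (i + 1) : ℚ)|) / 2 ^ k := by
  have hdet : V.det = ∏ i ∈ Finset.range k, ((-1) ^ i * (n (i + 1) : ℚ) / 2) := by
    rw [Matrix.det_of_isLowerTriangular V ?_, Finset.prod_range]
    · refine Finset.prod_congr rfl fun i _ => ?_
      rw [hV, if_pos rfl]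
    · intro i j hij
      have h : (i : ℕ) < (j : ℕ) := by simpa using hij
      rw [hV, if_neg (by intro e; rw [e] at h; omega), if_neg (by omega)]
  have hP' : P = ((Polynomial.X : Polynomial ℚ) • (-Vᵀ).map Polynomial.C + V.map Polynomial.C).det := by
    rw [hP]
    congr 1
    ext1 i j
    simp
    ring
  have hdeg := Polynomial.natDegree_det_X_add_C_le (-Vᵀ) V
  have h0 := Polynomial.coeff_det_X_add_C_zero (-Vᵀ) V
  have h1 := Polynomial.coeff_det_X_add_C_card (-Vᵀ) V
  rw [← hP'] at hdeg h0 h1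
  rw [Fintype.card_fin] at hdeg h1
  rw [Matrix.det_neg, Matrix.det_transpose, Fintype.card_fin, hdet] at h1
  rw [hdet] at h0
  have hne : P.coeff k ≠ 0 := by
    rw [h1]
    refine mul_ne_zero (pow_ne_zero _ (by norm_num)) (Finset.prod_ne_zero_iff.2 fun i hi => ?_)
    have hi' := Finset.mem_range.1 hi
    have : (n (i + 1) : ℚ) ≠ 0 := by exact_mod_cast hn (i + 1) (by omega) (by omega)
    exact div_ne_zero (mul_ne_zero (pow_ne_zero _ (by norm_num)) this) (by norm_num)
  have habs : |∏ i ∈ Finset.range k, ((-1) ^ i * (n (i + 1) : ℚ) / 2)|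
      = (∏ i ∈ Finset.range k, |(n (i + 1) : ℚ)|) / 2 ^ k := by
    rw [Finset.abs_prod]
    simp [abs_div, abs_mul, Finset.prod_div_distrib]
  refine ⟨le_antisymm hdeg (Polynomial.le_natDegree_of_ne_zero hne), hne, h0, h1, ?_, ?_⟩
  · rw [h0, habs]
  · rw [h1, abs_mul, habs]
    simp
end

section
/- Let k ≥ 1 and let n_1, …, n_k be integers with |n_i| ≥ 2 for all i. Let A be the real symmetric tridiagonal k×k matrix with diagonal entries A_{ii} = (−1)^{i+1} n_i and off-diagonal entries A_{i,i+1} = A_{i+1,i} = 1, and let λ_1, …, λ_k be its eigenvalues listed with multiplicity. Let N⁺ = #{i : (−1)^{i+1} n_i > 0} and N⁻ = #{i : (−1)^{i+1} n_i < 0}. Then no eigenvalue of A is zero, exactly N⁺ of the eigenvalues are positive, and exactly N⁻ of the eigenvalues are negative; hence the signature of A equals N⁺ − N⁻. -/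
open Matrix

lemma aux_quad_nat (d y : ℕ → ℝ) (ε : ℝ) (hε : ε * ε = 1)
    (h : ∀ i, 2 * y i ^ 2 ≤ ε * (d i * y i ^ 2)) (F : ℕ → ℝ)
    (h0 : F 0 = d 0 * y 0 ^ 2)
    (hs : ∀ k, F (k+1) = F k + d (k+1) * y (k+1) ^ 2 + 2 * (y k * y (k+1))) (k : ℕ) :
    y k ^ 2 ≤ ε * F k ∧ (ε * F k ≤ y k ^ 2 → ∀ i ≤ k, y i = 0) := by
  induction k with
  | zero =>
    have := h 0
    rw [h0]
    refine ⟨by nlinarith [sq_nonneg (y 0)], fun h1 i hi => ?_⟩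
    obtain rfl : i = 0 := by omega
    have : y 0 ^ 2 = 0 := le_antisymm (by linarith) (sq_nonneg _)
    exact pow_eq_zero_iff (two_ne_zero) |>.1 this
  | succ k ih =>
    obtain ⟨i1, i2⟩ := ih
    have hk := h (k+1)
    have e : ε * F (k+1) = ε * F k + ε * (d (k+1) * y (k+1)^2) + 2 * ε * (y k * y (k+1)) := by
      rw [hs]; ring
    have e2 : (y k + ε * y (k+1))^2 = y k ^2 + 2 * ε * (y k * y (k+1)) + y (k+1)^2 := by
      linear_combination (y (k+1))^2 * hε
    have p := sq_nonneg (y k + ε * y (k+1))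
    refine ⟨by linarith, fun h1 i hi => ?_⟩
    have z := i2 (by linarith)
    rcases Nat.lt_or_ge k i with hik | hik
    · obtain rfl : i = k + 1 := by omega
      have zk := z k le_rfl
      rw [zk] at e2 e i1
      have : y (k+1) ^ 2 = 0 := le_antisymm (by nlinarith) (sq_nonneg _)
      exact pow_eq_zero_iff (two_ne_zero) |>.1 this
    · exact z i hik

lemma aux_F (d y : ℕ → ℝ) (a : ℕ → ℕ → ℝ)
    (ha : ∀ i j, a i j = if i = j then d i else if i = j + 1 ∨ j = i + 1 then 1 else 0) (k : ℕ) :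
    ∑ i ∈ Finset.range (k+2), ∑ j ∈ Finset.range (k+2), y i * (a i j * y j) =
    ∑ i ∈ Finset.range (k+1), ∑ j ∈ Finset.range (k+1), y i * (a i j * y j)
      + d (k+1) * y (k+1)^2 + 2 * (y k * y (k+1)) := by
  have h1 : ∑ i ∈ Finset.range (k+1), y i * (a i (k+1) * y (k+1)) = y k * y (k+1) := by
    rw [Finset.sum_eq_single_of_mem k (by simp)]
    · simp [ha]
    · intro b hb hne
      have := Finset.mem_range.1 hb
      rw [ha, if_neg (by omega), if_neg (by omega)]; simp
  have h2 : ∑ i ∈ Finset.range (k+1), y (k+1) * (a (k+1) i * y i) = y k * y (k+1) := by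
    rw [Finset.sum_eq_single_of_mem k (by simp)]
    · simp [ha, mul_comm]
    · intro b hb hne
      have := Finset.mem_range.1 hb
      rw [ha, if_neg (by omega), if_neg (by omega)]; simp
  rw [Finset.sum_range_succ _ (k+1)]
  simp_rw [Finset.sum_range_succ _ (k+1)]
  rw [Finset.sum_add_distrib, h1, h2, ha (k+1) (k+1), if_pos rfl]
  ring

lemma aux_spec {k : ℕ} (A : Matrix (Fin k) (Fin k) ℝ) (hH : A.IsHermitian) (x : Fin k → ℝ) :
    x ⬝ᵥ (A *ᵥ x) = ∑ i, hH.eigenvalues i *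
      (((hH.eigenvectorUnitary : Matrix (Fin k) (Fin k) ℝ)ᵀ *ᵥ x) i) ^ 2 := by
  set U : Matrix (Fin k) (Fin k) ℝ := (hH.eigenvectorUnitary).1 with hU
  have h : A = U * diagonal hH.eigenvalues * Uᵀ := by
    have := hH.spectral_theorem
    rw [Unitary.conjStarAlgAut_apply] at this
    simpa [star_eq_conjTranspose] using this
  conv_lhs => rw [h, ← mulVec_mulVec, ← mulVec_mulVec, dotProduct_mulVec, ← mulVec_transpose]
  simp only [dotProduct, mulVec_diagonal]
  exact Finset.sum_congr rfl fun i _ => by ring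

lemma aux_count {k : ℕ} (A : Matrix (Fin k) (Fin k) ℝ) (hH : A.IsHermitian) (ε : ℝ)
    (S : Finset (Fin k))
    (hS : ∀ x : Fin k → ℝ, (∀ i, i ∉ S → x i = 0) → ε * (x ⬝ᵥ (A *ᵥ x)) ≤ 0 → x = 0) :
    S.card ≤ (Finset.univ.filter fun i => 0 < ε * hH.eigenvalues i).card := by
  set T := Finset.univ.filter fun i => 0 < ε * hH.eigenvalues i with hT
  set U : Matrix (Fin k) (Fin k) ℝ := (hH.eigenvectorUnitary).1 with hU
  let f : (S → ℝ) →ₗ[ℝ] (T → ℝ) :=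
    LinearMap.funLeft ℝ ℝ (Subtype.val : T → Fin k) ∘ₗ (Uᵀ).mulVecLin ∘ₗ
      Function.ExtendByZero.linearMap ℝ (Subtype.val : S → Fin k)
  have hf : Function.Injective f := by
    rw [← LinearMap.ker_eq_bot, LinearMap.ker_eq_bot']
    intro m hm
    have hx := hS (Function.extend Subtype.val m 0) ?_ ?_
    · funext i
      have := congrFun hx i
      rwa [Subtype.val_injective.extend_apply] at this
    · intro i hi
      rw [Function.extend_apply' _ _ _ (by rintro ⟨a, rfl⟩; exact hi a.2)]; rfl
    · rw [aux_spec A hH, Finset.mul_sum]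
      refine Finset.sum_nonpos fun i _ => ?_
      by_cases hi : i ∈ T
      · have : (Uᵀ *ᵥ (Function.extend Subtype.val m 0)) i = 0 := congrFun hm ⟨i, hi⟩
        rw [this]; simp
      · have : ε * hH.eigenvalues i ≤ 0 := by simpa [hT] using hi
        rw [← mul_assoc]
        exact mul_nonpos_of_nonpos_of_nonneg this (sq_nonneg _)
  simpa using LinearMap.finrank_le_finrank_of_injective hf

theorem aux_pd (k : ℕ) (hk : 1 ≤ k) (d : ℕ → ℝ)
    (A : Matrix (Fin k) (Fin k) ℝ)
    (hA : ∀ i j : Fin k, A i j =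
      if i = j then d i
      else if (i : ℕ) = (j : ℕ) + 1 ∨ (j : ℕ) = (i : ℕ) + 1 then 1 else 0)
    (ε : ℝ) (hε : ε * ε = 1) (x : Fin k → ℝ)
    (hx : ∀ i : Fin k, x i ≠ 0 → 2 ≤ ε * d i) (hQ : ε * (x ⬝ᵥ (A *ᵥ x)) ≤ 0) : x = 0 := by
  obtain ⟨m, rfl⟩ : ∃ m, k = m + 1 := ⟨k - 1, by omega⟩
  let y : ℕ → ℝ := fun i => if h : i < m + 1 then x ⟨i, h⟩ else 0
  have hy : ∀ i : Fin (m+1), y i = x i := fun i => dif_pos i.2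
  let a : ℕ → ℕ → ℝ := fun i j => if i = j then d i else if i = j + 1 ∨ j = i + 1 then 1 else 0
  let F : ℕ → ℝ := fun k =>
    ∑ i ∈ Finset.range (k+1), ∑ j ∈ Finset.range (k+1), y i * (a i j * y j)
  have hF : x ⬝ᵥ (A *ᵥ x) = F m := by
    simp only [F, dotProduct, mulVec, Finset.sum_range, Finset.mul_sum, hy, hA, a, Fin.ext_iff]
  have := aux_quad_nat d y ε hε ?_ F (by simp [F, a]; ring) (fun k => aux_F d y a (fun _ _ => rfl) k) m
  · rw [hF] at hQ
    funext i
    rw [← hy i]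
    exact this.2 (hQ.trans (sq_nonneg _)) i (by omega)
  · intro i
    by_cases h0 : y i = 0
    · simp [h0]
    · have hi : i < m + 1 := by
        by_contra hc; exact h0 (dif_neg hc)
      have := hx ⟨i, hi⟩ (by rw [← hy]; exact h0)
      simp only at this
      nlinarith [sq_nonneg (y i)]



/-- Proposition 3.3.  Let `k ≥ 1` and let `n_1, …, n_k` be integers
with `|n_i| ≥ 2`.  Let `A` be the real symmetric tridiagonal matrix with diagonal
`(-1)^{i+1} n_i` (1-indexed) and off-diagonal entries `1`.  Then no eigenvalue of `A`
is zero, and the numbers of positive and negative eigenvalues are, respectively,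
`N⁺ = #{i : (-1)^{i+1} n_i > 0}` and `N⁻ = #{i : (-1)^{i+1} n_i < 0}`; hence the
signature of `A` is `N⁺ - N⁻`. -/
theorem state_signature_eq_Nplus_sub_Nminus (k : ℕ) (hk : 1 ≤ k)
    (n : ℕ → ℤ) (hn : ∀ i, 1 ≤ i → i ≤ k → 2 ≤ |n i|)
    (A : Matrix (Fin k) (Fin k) ℝ)
    (hA : ∀ i j : Fin k, A i j =
      if i = j then ((-1) ^ (i : ℕ) * n ((i : ℕ) + 1) : ℤ)
      else if (i : ℕ) = (j : ℕ) + 1 ∨ (j : ℕ) = (i : ℕ) + 1 then 1 else 0)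
    (hHerm : A.IsHermitian) :
    (∀ i, hHerm.eigenvalues i ≠ 0) ∧
    (Finset.univ.filter fun i => 0 < hHerm.eigenvalues i).card
      = (Finset.univ.filter fun i : Fin k => 0 < (-1) ^ (i : ℕ) * n ((i : ℕ) + 1)).card ∧
    (Finset.univ.filter fun i => hHerm.eigenvalues i < 0).card
      = (Finset.univ.filter fun i : Fin k => (-1) ^ (i : ℕ) * n ((i : ℕ) + 1) < 0).card ∧
    ((Finset.univ.filter fun i => 0 < hHerm.eigenvalues i).card : ℤ)
      - (Finset.univ.filter fun i => hHerm.eigenvalues i < 0).card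
      = ((Finset.univ.filter fun i : Fin k => 0 < (-1) ^ (i : ℕ) * n ((i : ℕ) + 1)).card : ℤ)
        - (Finset.univ.filter fun i : Fin k => (-1) ^ (i : ℕ) * n ((i : ℕ) + 1) < 0).card := by
  set c : Fin k → ℤ := fun i => (-1) ^ (i : ℕ) * n ((i : ℕ) + 1) with hc
  have habs : ∀ i : Fin k, 2 ≤ |c i| := fun i => by
    have := hn (i+1) (by omega) (by omega)
    simpa [hc, abs_mul] using this
  let d : ℕ → ℝ := fun i => ((-1) ^ i * n (i + 1) : ℤ)
  have hd : ∀ i : Fin k, d i = (c i : ℝ) := fun i => rfl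
  have hA' : ∀ i j : Fin k, A i j = if i = j then d i
      else if (i : ℕ) = (j : ℕ) + 1 ∨ (j : ℕ) = (i : ℕ) + 1 then 1 else 0 := fun i j => by
    rw [hA, apply_ite (Int.cast : ℤ → ℝ), apply_ite (Int.cast : ℤ → ℝ), Int.cast_one, Int.cast_zero]
  have hP := aux_count A hHerm 1 (Finset.univ.filter fun i => 0 < c i) fun x hx hQ => by
    refine aux_pd k hk d A hA' 1 (by norm_num) x (fun i hi => ?_) hQ
    have h1 : 0 < c i := by
      by_contra h; exact hi (hx i (by simpa using h))
    have h2 := habs i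
    rw [abs_of_pos h1] at h2
    rw [hd, one_mul]; exact_mod_cast h2
  have hN := aux_count A hHerm (-1) (Finset.univ.filter fun i => c i < 0) fun x hx hQ => by
    refine aux_pd k hk d A hA' (-1) (by norm_num) x (fun i hi => ?_) hQ
    have h1 : c i < 0 := by
      by_contra h; exact hi (hx i (by simpa using h))
    have h2 := habs i
    rw [abs_of_neg h1] at h2
    rw [hd, neg_one_mul]; exact_mod_cast h2
  simp only [one_mul, neg_one_mul, Left.neg_pos_iff] at hP hN
  have hcd : Disjoint (Finset.univ.filter fun i => 0 < c i) (Finset.univ.filter fun i => c i < 0) :=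
    Finset.disjoint_filter.2 fun i _ h => by omega
  have hcu : (Finset.univ.filter fun i => 0 < c i) ∪ (Finset.univ.filter fun i => c i < 0)
      = Finset.univ := by
    ext i
    have h2 := habs i
    have : c i ≠ 0 := by intro h; rw [h] at h2; norm_num at h2
    simp only [Finset.mem_union, Finset.mem_filter, Finset.mem_univ, true_and, iff_true]
    omega
  have hcc := Finset.card_union_of_disjoint hcd
  rw [hcu, Finset.card_univ, Fintype.card_fin] at hcc
  have hed : Disjoint (Finset.univ.filter fun i => 0 < hHerm.eigenvalues i)
      (Finset.univ.filter fun i => hHerm.eigenvalues i < 0) :=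
    Finset.disjoint_filter.2 fun i _ h => not_lt.2 h.le
  have hec := Finset.card_union_of_disjoint hed
  have hle := Finset.card_le_univ ((Finset.univ.filter fun i => 0 < hHerm.eigenvalues i) ∪
      (Finset.univ.filter fun i => hHerm.eigenvalues i < 0))
  rw [Fintype.card_fin] at hle
  have e1 : (Finset.univ.filter fun i => 0 < hHerm.eigenvalues i).card
      = (Finset.univ.filter fun i => 0 < c i).card := by omega
  have e2 : (Finset.univ.filter fun i => hHerm.eigenvalues i < 0).card
      = (Finset.univ.filter fun i => c i < 0).card := by omega
  refine ⟨fun i h0 => ?_, e1, e2, by rw [e1, e2]⟩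
  have hu := (Finset.card_eq_iff_eq_univ ((Finset.univ.filter fun i => 0 < hHerm.eigenvalues i) ∪
      (Finset.univ.filter fun i => hHerm.eigenvalues i < 0))).1 (by rw [Fintype.card_fin]; omega)
  have := Finset.mem_univ i
  rw [← hu] at this
  simp [h0] at this
end

section
/- Let k ≥ 2, let n_1, …, n_k be integers, and let V be the associated state matrix over ℚ. Fix i with 1 ≤ i ≤ k−1, and let V′ be the matrix that agrees with V in every entry except that V′_{i,i+1} = 1 and V′_{i+1,i} = 0 (whereas V_{i,i+1} = 0 and V_{i+1,i} = 1). Then det(V′ − t·V′ᵀ) = det(V − t·Vᵀ) as polynomials in ℚ[t]. -/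
open Matrix Polynomial

/-- Let `k ≥ 2`, let `n_1, …, n_k` be integers, and let `V` be the
associated state matrix over `ℚ` (diagonal `(-1)^{i+1} n_i / 2`, subdiagonal entries `1`).
For `1 ≤ i ≤ k-1`, let `V'` agree with `V` in every entry except `V'_{i,i+1} = 1` and
`V'_{i+1,i} = 0`.  Then `det (V' - t V'ᵀ) = det (V - t Vᵀ)` in `ℚ[t]`.
(Key computation in the proof of Theorem 2.4: the state polynomial is independent of
the choice of normal vector `N_{i,i+1}`.) -/
theorem state_polynomial_indep_of_normal_vector (k : ℕ) (hk : 2 ≤ k)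
    (n : ℕ → ℤ)
    (V V' : Matrix (Fin k) (Fin k) ℚ)
    (hV : ∀ a b : Fin k, V a b =
      if a = b then (-1) ^ (a : ℕ) * (n ((a : ℕ) + 1) : ℚ) / 2
      else if (a : ℕ) = (b : ℕ) + 1 then 1 else 0)
    (i : Fin k) (hi : (i : ℕ) + 1 < k)
    (hV' : ∀ a b : Fin k, V' a b =
      if a = i ∧ b = ⟨(i : ℕ) + 1, hi⟩ then 1
      else if a = ⟨(i : ℕ) + 1, hi⟩ ∧ b = i then 0
      else V a b) :
    (V'.map Polynomial.C - (Polynomial.X : Polynomial ℚ) • (V'ᵀ).map Polynomial.C).det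
      = (V.map Polynomial.C - (Polynomial.X : Polynomial ℚ) • (Vᵀ).map Polynomial.C).det := by
  set d : Fin k → Polynomial ℚ := fun a => if (a : ℕ) ≤ i then 1 else -X with hd
  have hdet : (diagonal d).det ≠ 0 := by
    rw [det_diagonal, Finset.prod_ne_zero_iff]
    intro a _
    simp only [hd]
    split_ifs
    · exact one_ne_zero
    · exact neg_ne_zero.mpr X_ne_zero
  have key : (V'.map C - (X : Polynomial ℚ) • (V'ᵀ).map C) * diagonal d
      = diagonal d * (V.map C - (X : Polynomial ℚ) • (Vᵀ).map C) := by
    ext1 a b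
    rw [mul_diagonal, diagonal_mul]
    simp only [Matrix.sub_apply, Matrix.smul_apply, Matrix.map_apply, transpose_apply, smul_eq_mul, hV', hV, hd,
      Fin.ext_iff]
    by_cases h1 : (a : ℕ) = i ∧ (b : ℕ) = i + 1
    · obtain ⟨h1, h2⟩ := h1
      simp [h1, h2, show ¬((i : ℕ) = i + 1 + 1) by omega]
    by_cases h2 : (b : ℕ) = i ∧ (a : ℕ) = i + 1
    · obtain ⟨h2, h3⟩ := h2
      simp [h2, h3, show ¬((i : ℕ) = i + 1 + 1) by omega]
    have h3 : ¬((a : ℕ) = i + 1 ∧ (b : ℕ) = i) := fun h => h2 ⟨h.2, h.1⟩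
    have h4 : ¬((b : ℕ) = i + 1 ∧ (a : ℕ) = i) := fun h => h1 ⟨h.2, h.1⟩
    simp only [if_neg h1, if_neg h2, if_neg h3, if_neg h4]
    by_cases hab : ((a : ℕ) ≤ i ↔ (b : ℕ) ≤ i)
    · simp only [hab]
      ring
    · rw [if_neg (c := (a : ℕ) = b) (by omega), if_neg (c := (b : ℕ) = a) (by omega),
        if_neg (c := (a : ℕ) = b + 1) (by omega), if_neg (c := (b : ℕ) = a + 1) (by omega)]
      simp
  have h := congrArg det key
  rw [det_mul, det_mul, mul_comm] at h
  exact mul_left_cancel₀ hdet h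
end

section
/- Let k ≥ 1 and let n_1, …, n_k be integers with |n_i| ≥ 2 for all i, and define c_1 = n_1 and c_j = n_j + 1/c_{j−1} for 2 ≤ j ≤ k. Let A be the real symmetric tridiagonal k×k matrix with diagonal entries A_{ii} = (−1)^{i+1} n_i and off-diagonal entries A_{i,i+1} = A_{i+1,i} = 1, and let D be the diagonal k×k real matrix with diagonal entries D_{ii} = (−1)^{i+1} c_i. Then there exists an invertible lower-triangular real matrix L with all diagonal entries equal to 1 such that A = L·D·Lᵀ; in particular A is congruent over ℝ to D. -/
open Matrix

theorem GL_row_sum (k : ℕ) (l : ℕ → ℝ) (f : Fin k → ℝ) (i : Fin k) :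
    ∑ m : Fin k, (if i = m then 1 else if (i : ℕ) = (m : ℕ) + 1 then l m else 0) * f m
      = f i + (if h : 0 < (i : ℕ) then l (i - 1) * f ⟨i - 1, by omega⟩ else 0) := by
  have h1 : ∀ m : Fin k,
      (if i = m then 1 else if (i : ℕ) = (m : ℕ) + 1 then l m else 0) * f m
      = (if i = m then f m else 0) + (if (i : ℕ) = (m : ℕ) + 1 then l m * f m else 0) := by
    intro m
    by_cases h : i = m
    · subst h
      simp
    · simp [h]
  rw [Finset.sum_congr rfl (fun m _ => h1 m), Finset.sum_add_distrib]
  congr 1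
  · simp
  · split_ifs with h
    · rw [Finset.sum_eq_single (⟨i - 1, by omega⟩ : Fin k)]
      · rw [if_pos]
        simp only
        omega
      · intro b _ hb
        rw [if_neg]
        intro hh
        apply hb
        ext
        simp only
        omega
      · simp
    · apply Finset.sum_eq_zero
      intro m _
      rw [if_neg]
      omega

/-- Let `k ≥ 1`, `n_1, …, n_k` integers with `|n_i| ≥ 2`, and
`c_1 = n_1`, `c_j = n_j + 1/c_{j-1}` the continued-fraction tails.  Let `A` be the real
symmetric tridiagonal matrix with diagonal `(-1)^{i+1} n_i` (1-indexed) and off-diagonal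
entries `1`, and let `D` be the diagonal matrix with `D_{ii} = (-1)^{i+1} c_i`.  Then
there is an invertible lower-triangular real matrix `L` with unit diagonal such that
`A = L D Lᵀ`; in particular `A` is congruent over `ℝ` to `D`.
(The LDLᵀ form of the row reduction in the proof of Proposition 3.3.) -/
theorem GL_matrix_LDLt_decomposition (k : ℕ) (hk : 1 ≤ k)
    (n : ℕ → ℤ) (hn : ∀ i, 1 ≤ i → i ≤ k → 2 ≤ |n i|)
    (c : ℕ → ℝ) (hc1 : c 1 = (n 1 : ℝ))
    (hc : ∀ j, 2 ≤ j → j ≤ k → c j = (n j : ℝ) + 1 / c (j - 1))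
    (A : Matrix (Fin k) (Fin k) ℝ)
    (hA : ∀ i j : Fin k, A i j =
      if i = j then ((-1) ^ (i : ℕ) * n ((i : ℕ) + 1) : ℤ)
      else if (i : ℕ) = (j : ℕ) + 1 ∨ (j : ℕ) = (i : ℕ) + 1 then 1 else 0)
    (D : Matrix (Fin k) (Fin k) ℝ)
    (hD : D = Matrix.diagonal fun i : Fin k => (-1) ^ (i : ℕ) * c ((i : ℕ) + 1)) :
    ∃ L : Matrix (Fin k) (Fin k) ℝ,
      (∀ i j : Fin k, i < j → L i j = 0) ∧
      (∀ i : Fin k, L i i = 1) ∧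
      IsUnit L ∧
      A = L * D * Lᵀ := by
  have habs : ∀ j, 1 ≤ j → j ≤ k → 1 < |c j| := by
    intro j hj
    induction j, hj using Nat.le_induction with
    | base =>
      intro h
      have h2 := hn 1 le_rfl h
      have h3 : (2 : ℝ) ≤ |(n 1 : ℝ)| := by exact_mod_cast h2
      rw [hc1]
      linarith
    | succ j hj ih =>
      intro h
      have h1 := ih (by omega)
      have h2 := hn (j + 1) (by omega) h
      have h3 : (2 : ℝ) ≤ |(n (j + 1) : ℝ)| := by exact_mod_cast h2
      have h4 := hc (j + 1) (by omega) h
      rw [Nat.add_sub_cancel] at h4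
      have h5 : |1 / c j| < 1 := by
        rw [abs_div, abs_one, div_lt_one (by linarith)]
        exact h1
      have h6 := abs_sub_abs_le_abs_sub (n (j + 1) : ℝ) (-(1 / c j))
      rw [abs_neg, sub_neg_eq_add, ← h4] at h6
      linarith
  have hne : ∀ j, 1 ≤ j → j ≤ k → c j ≠ 0 := by
    intro j h1 h2 h
    have := habs j h1 h2
    rw [h, abs_zero] at this
    linarith
  have hsq : ∀ j : ℕ, ((-1 : ℝ) ^ j) * (-1) ^ j = 1 := by
    intro j
    rw [← mul_pow]
    simp
  let l : ℕ → ℝ := fun j => (-1) ^ j / c (j + 1)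
  let L : Matrix (Fin k) (Fin k) ℝ := Matrix.of fun i m =>
    if i = m then 1 else if (i : ℕ) = (m : ℕ) + 1 then l m else 0
  have hlow : ∀ i j : Fin k, i < j → L i j = 0 := by
    intro i j hij
    have h2 : (i : ℕ) < j := hij
    simp only [L, Matrix.of_apply]
    rw [if_neg hij.ne, if_neg (by omega)]
  have hdiag : ∀ i : Fin k, L i i = 1 := by
    intro i
    simp [L]
  refine ⟨L, hlow, hdiag, ?_, ?_⟩
  · rw [Matrix.isUnit_iff_isUnit_det, Matrix.det_of_isLowerTriangular L (fun i j h => hlow i j h)]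
    simp [hdiag]
  · ext i j
    rw [hA, hD, Matrix.mul_apply]
    simp only [Matrix.mul_diagonal, Matrix.transpose_apply, mul_assoc]
    simp only [L, Matrix.of_apply]
    rw [GL_row_sum k l (fun m : Fin k => (-1) ^ (m : ℕ) * (c ((m : ℕ) + 1) *
      (if j = m then 1 else if (j : ℕ) = (m : ℕ) + 1 then l m else 0)))]
    obtain ⟨i, hi⟩ := i
    obtain ⟨j, hj⟩ := j
    simp only [Fin.mk.injEq]
    rcases i with _ | i
    · rcases j with _ | j
      · simp [hc1]
      · rcases j with _ | j
        · have := hne 1 le_rfl hk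
          simp [l, this]
        · simp
    · have e1 := hne (i + 1) (by omega) (by omega)
      have e2 := hc (i + 1 + 1) (by omega) (by omega)
      have e3 := hsq i
      simp only [Nat.add_sub_cancel] at e2 ⊢
      have e4 : l i * ((-1) ^ i * c (i + 1)) = 1 := by
        simp only [l]
        field_simp
        linarith
      rw [dif_pos (Nat.succ_pos i)]
      by_cases h1 : i + 1 = j
      · subst h1
        simp only [if_true, if_neg (Nat.succ_ne_self i)]
        rw [e2]
        have e5 : l i * ((-1) ^ i * (c (i + 1) * l i)) = l i := by
          linear_combination l i * e4
        rw [e5]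
        simp only [l]
        push_cast
        ring
      · by_cases h2 : i = j
        · subst h2
          have a3 : ¬ i = i + 1 + 1 := by omega
          simp [a3]
          linarith
        · by_cases h3 : j = i + 1 + 1
          · subst h3
            have e6 := hne (i + 1 + 1) (by omega) (by omega)
            have e7 := hsq (i + 1)
            have a3 : ¬ i + 1 + 1 = i := by omega
            simp [l, a3]
            field_simp
            linarith
          · have a1 : ¬ j = i + 1 := fun h => h1 h.symm
            have a2 : ¬ j = i := fun h => h2 h.symm
            simp [a1, a2, h1, h2, h3]
end

section
/- Let k ≥ 1 and let n_1, …, n_k be integers with |n_i| ≥ 2 for all i. Then the symmetric tridiagonal k×k rational matrix A with diagonal entries A_{ii} = (−1)^{i+1} n_i and off-diagonal entries A_{i,i+1} = A_{i+1,i} = 1 has nonzero determinant; in particular the Gordon–Litherland form of every essential spanning surface corresponding to such a continued fraction expansion is nondegenerate, and the determinant of the corresponding 2-bridge knot |Δ_S(−1)| = |det(A)| is nonzero. -/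
open Matrix

/-- Let `k ≥ 1` and `n_1, …, n_k` be integers with `|n_i| ≥ 2`.
Then the symmetric tridiagonal `k × k` rational matrix `A` with diagonal entries
`(-1)^{i+1} n_i` (1-indexed) and off-diagonal entries `1` has nonzero determinant:
the Gordon–Litherland form of such an essential spanning surface is nondegenerate
and the corresponding 2-bridge knot determinant `|Δ_S(-1)| = |det A|` is nonzero. -/
theorem GL_matrix_det_ne_zero (k : ℕ) (hk : 1 ≤ k)
    (n : ℕ → ℤ) (hn : ∀ i, 1 ≤ i → i ≤ k → 2 ≤ |n i|)
    (A : Matrix (Fin k) (Fin k) ℚ)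
    (hA : ∀ i j : Fin k, A i j =
      if i = j then ((-1) ^ (i : ℕ) * n ((i : ℕ) + 1) : ℤ)
      else if (i : ℕ) = (j : ℕ) + 1 ∨ (j : ℕ) = (i : ℕ) + 1 then 1 else 0) :
    A.det ≠ 0 := by
  intro hdet
  obtain ⟨v, hv, hAv⟩ := Matrix.exists_mulVec_eq_zero_iff.mpr hdet
  let u : ℕ → ℚ := fun m => if h : 1 ≤ m ∧ m ≤ k then v ⟨m - 1, by omega⟩ else 0
  have hu0 : u 0 = 0 := by simp [u]
  have huk : u (k + 1) = 0 := by simp [u]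
  have huv : ∀ j : Fin k, v j = u ((j : ℕ) + 1) := by
    intro j
    have : (1 ≤ (j : ℕ) + 1 ∧ (j : ℕ) + 1 ≤ k) := ⟨by omega, j.2⟩
    simp only [u, dif_pos this, Nat.add_sub_cancel]
  have hrow : ∀ i, i < k →
      u i + ((((-1) ^ i * n (i + 1) : ℤ)) : ℚ) * u (i + 1) + u (i + 2) = 0 := by
    intro i hi
    have h1 := congrFun hAv ⟨i, hi⟩
    simp only [Matrix.mulVec, dotProduct, Pi.zero_apply] at h1
    have h2 : ∀ j : Fin k, A ⟨i, hi⟩ j * v j =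
        (fun m : ℕ => (if m = i then ((((-1) ^ i * n (i + 1) : ℤ)) : ℚ) * u (i + 1) else 0)
          + (if m + 1 = i then u i else 0) + (if m = i + 1 then u (i + 2) else 0)) (j : ℕ) := by
      intro j
      rw [hA, huv]
      simp only [Fin.ext_iff]
      by_cases a : i = (j : ℕ)
      · subst a
        simp
      · by_cases b : (j : ℕ) + 1 = i
        · subst b
          simp
          intro h
          omega
        · by_cases c : (j : ℕ) = i + 1
          · rw [c]
            simp
            intro h
            omega
          · simp [a, b, c, Ne.symm a, Ne.symm b]
    rw [Finset.sum_congr rfl (fun j _ => h2 j), Fin.sum_univ_eq_sum_range (fun m : ℕ => (if m = i then ((((-1) ^ i * n (i + 1) : ℤ)) : ℚ) * u (i + 1) else 0)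
          + (if m + 1 = i then u i else 0) + (if m = i + 1 then u (i + 2) else 0)) k,
      Finset.sum_add_distrib, Finset.sum_add_distrib, Finset.sum_ite_eq',
      Finset.sum_ite_eq'] at h1
    have h3 : (∑ m ∈ Finset.range k, if m + 1 = i then u i else 0) = u i := by
      rcases i with _ | i
      · simp [hu0]
      · simp only [Nat.add_right_cancel_iff]
        rw [Finset.sum_ite_eq', if_pos (Finset.mem_range.mpr (by omega))]
    have h4 : (if i + 1 ∈ Finset.range k then u (i + 2) else 0) = u (i + 2) := by
      split_ifs with h
      · rfl
      · have : i + 1 = k := by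
          simp only [Finset.mem_range] at h
          omega
        rw [← huk, ← this]
    rw [h3, h4, if_pos (Finset.mem_range.mpr hi)] at h1
    linarith
  have hmono : ∀ i, i ≤ k → |u i| ≤ |u (i + 1)| := by
    intro i
    induction i with
    | zero => intro _; simp [hu0]
    | succ i ih =>
      intro hi
      have h1 := ih (by omega)
      have h2 := hrow i (by omega)
      have h3 : (2 : ℚ) ≤ |((((-1) ^ i * n (i + 1) : ℤ)) : ℚ)| := by
        have h := hn (i + 1) (by omega) hi
        rw [← Int.cast_abs, abs_mul, abs_pow]
        simp only [abs_neg, abs_one, one_pow, one_mul]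
        exact_mod_cast h
      have h4 : ((((-1) ^ i * n (i + 1) : ℤ)) : ℚ) * u (i + 1) = -(u i + u (i + 2)) := by
        linarith
      have h5 := congrArg abs h4
      rw [abs_mul, abs_neg] at h5
      have h6 := abs_add_le (u i) (u (i + 2))
      have h7 := mul_le_mul_of_nonneg_right h3 (abs_nonneg (u (i + 1)))
      show |u (i + 1)| ≤ |u (i + 2)|
      linarith
  have hz : ∀ d i, i + d = k + 1 → u i = 0 := by
    intro d
    induction d with
    | zero => intro i hi; rw [show i = k + 1 by omega]; exact huk
    | succ d ih =>
      intro i hi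
      have h1 := ih (i + 1) (by omega)
      have h2 := hmono i (by omega)
      rw [h1, abs_zero] at h2
      exact abs_nonpos_iff.mp h2
  apply hv
  funext j
  rw [huv]
  exact hz (k - j) _ (by omega)
end
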